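/- arXiv:2303.09475 — 2 statements merged into one kernel-verified Lean document; each statement's English description precedes it below -/
import Mathlib

section
/- Let f̲ ∈ C([0,T]; 𝓜^I₊) be the limit obtained in the negligible-fusion theorem (a weak solution of the two-dimensional pure coagulation equation with kernel K and initial datum f_in, satisfying sup_{t∈[0,T]} ∫ (a² + v^{−2} + v²) df̲(t) ≤ C(T)). Then both the total area and the total volume are conserved: for every t ∈ [0,T], ∫ a df̲(t)(a,v) = ∫ a df_in(a,v) and ∫ v df̲(t)(a,v) = ∫ v df_in(a,v). -/
open MeasureTheory Real Set Filter Topology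
open scoped ENNReal

noncomputable section

/-- `c₀ = (36π)^(1/3)`, the isoperimetric constant relating area and volume of a ball. -/
def c0 : ℝ := (36 * Real.pi) ^ ((1 : ℝ) / 3)

/-- The open quadrant `(0,∞)²` of pairs `(a,v)` (surface area, volume). -/
def Quad : Set (ℝ × ℝ) := {p | 0 < p.1 ∧ 0 < p.2}

/-- The isoperimetric region `{(a,v) : v > 0, a ≥ c₀ v^(2/3)}`. -/
def IsoRegion : Set (ℝ × ℝ) := {p | 0 < p.2 ∧ c0 * p.2 ^ ((2 : ℝ) / 3) ≤ p.1}

/-- A nonnegative (Radon) measure on `(0,∞)²` supported in `{a ≥ c₀ v^(2/3)}`: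
it gives zero mass to the complement of the isoperimetric region. -/
def IsIsoMeasure (m : Measure (ℝ × ℝ)) : Prop := m IsoRegionᶜ = 0

/-- `C₀((0,∞)²)`: continuous functions vanishing at infinity of the open quadrant
(extended by zero outside the quadrant). -/
def IsC0Quad (φ : ℝ × ℝ → ℝ) : Prop :=
  Continuous φ ∧ (∀ p, p ∉ Quad → φ p = 0) ∧
    ∀ δ > 0, ∃ Kc : Set (ℝ × ℝ), IsCompact Kc ∧ Kc ⊆ Quad ∧ ∀ p ∉ Kc, |φ p| ≤ δ

/-- `C_c((0,∞)²)`: continuous functions with compact support contained in the quadrant. -/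
def IsCcQuad (φ : ℝ × ℝ → ℝ) : Prop :=
  Continuous φ ∧ HasCompactSupport φ ∧ tsupport φ ⊆ Quad

/-- `C₀((0,∞))`: continuous functions on `(0,∞)` vanishing at infinity (extended by zero). -/
def IsC0Pos (φ : ℝ → ℝ) : Prop :=
  Continuous φ ∧ (∀ v, v ∉ Ioi (0 : ℝ) → φ v = 0) ∧
    ∀ δ > 0, ∃ Kc : Set ℝ, IsCompact Kc ∧ Kc ⊆ Ioi (0 : ℝ) ∧ ∀ v ∉ Kc, |φ v| ≤ δ

/-- `C_c((0,∞))`: continuous functions with compact support contained in `(0,∞)`. -/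
def IsCcPos (φ : ℝ → ℝ) : Prop :=
  Continuous φ ∧ HasCompactSupport φ ∧ tsupport φ ⊆ Ioi (0 : ℝ)

/-- Partial derivative in the area variable `a`. -/
def da (φ : ℝ × ℝ → ℝ) (p : ℝ × ℝ) : ℝ := deriv (fun a => φ (a, p.2)) p.1

/-- Time-dependent test functions `φ ∈ C¹_c([0,∞); C¹_c((0,∞)²))`. -/
def IsTestFun (ψ : ℝ × (ℝ × ℝ) → ℝ) : Prop :=
  ContDiff ℝ 1 ψ ∧ HasCompactSupport ψ ∧ ∀ q : ℝ × (ℝ × ℝ), q.2 ∉ Quad → ψ q = 0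

/-- The assumptions on the coagulation kernel `K`: continuity, symmetry, and the
two-sided power law bounds with constants `K₀ ≥ K₁ > 0` and exponents
`al > 0`, `be ∈ (0,1)`, `be - al ∈ (0,1)`. -/
structure IsCoagKernel (K : ℝ × ℝ → ℝ × ℝ → ℝ) (K₀ K₁ al be : ℝ) : Prop where
  cont : ContinuousOn (fun q : (ℝ × ℝ) × (ℝ × ℝ) => K q.1 q.2) (Quad ×ˢ Quad)
  symm : ∀ η η', K η η' = K η' η
  K1_pos : 0 < K₁
  K1_le_K0 : K₁ ≤ K₀
  al_pos : 0 < al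
  be_mem : be ∈ Ioo (0 : ℝ) 1
  be_sub_al_mem : be - al ∈ Ioo (0 : ℝ) 1
  lower : ∀ η ∈ Quad, ∀ η' ∈ Quad,
    K₁ * (η.2 ^ (-al) * η'.2 ^ be + η'.2 ^ (-al) * η.2 ^ be) ≤ K η η'
  upper : ∀ η ∈ Quad, ∀ η' ∈ Quad,
    K η η' ≤ K₀ * (η.2 ^ (-al) * η'.2 ^ be + η'.2 ^ (-al) * η.2 ^ be)

/-- The assumptions on an admissible fusion kernel `r`: positivity, `C¹` regularity,
two-sided power law bounds `R₀ a^mu v^sg ≤ r ≤ R₁ a^mu v^sg`, and the structural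
differential inequalities on the isoperimetric region. -/
structure IsFusionKernel (r : ℝ × ℝ → ℝ) (R₀ R₁ mu sg B : ℝ) : Prop where
  smooth : ContDiffOn ℝ 1 r Quad
  pos : ∀ η ∈ Quad, 0 < r η
  R0_pos : 0 < R₀
  R1_pos : 0 < R₁
  B_pos : 0 < B
  lower : ∀ η ∈ Quad, R₀ * η.1 ^ mu * η.2 ^ sg ≤ r η
  upper : ∀ η ∈ Quad, r η ≤ R₁ * η.1 ^ mu * η.2 ^ sg
  cond_pos : 0 < mu → ∀ η ∈ IsoRegion, 0 ≤ da r η - mu * η.1⁻¹ * r η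
  cond_nonpos : mu ≤ 0 → ∀ η ∈ IsoRegion,
    0 ≤ da r η * (η.1 - c0 * η.2 ^ ((2 : ℝ) / 3)) + r η
  cond_upper : ∀ η ∈ IsoRegion, da r η ≤ B * η.1⁻¹ * r η

/-- The weak identity at time `t` against the test function `ψ`, for the
fusion–coagulation equation with fusion coefficient `c` (the `Λ`-fusion problem
corresponds to `c = Λ⁻¹`). -/
def WeakIdentity (K : ℝ × ℝ → ℝ × ℝ → ℝ) (r : ℝ × ℝ → ℝ) (c : ℝ)
    (fin : Measure (ℝ × ℝ)) (f : ℝ → Measure (ℝ × ℝ))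
    (ψ : ℝ × (ℝ × ℝ) → ℝ) (t : ℝ) : Prop :=
  (∫ η, ψ (t, η) ∂(f t)) - (∫ η, ψ (0, η) ∂fin)
      - ∫ s in (0 : ℝ)..t, ∫ η, deriv (fun u => ψ (u, η)) s ∂(f s)
    = (∫ s in (0 : ℝ)..t, (1 / 2) *
        ∫ η, ∫ η', K η η' * (ψ (s, η + η') - ψ (s, η) - ψ (s, η')) ∂(f s) ∂(f s))
      + c * ∫ s in (0 : ℝ)..t,
          ∫ η, r η * (c0 * η.2 ^ ((2 : ℝ) / 3) - η.1) * da (fun p => ψ (s, p)) η ∂(f s)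

/-- A weak solution of the fusion–coagulation problem with fusion coefficient `c`
(power-law exponents `al`, `be` of the coagulation kernel enter the a priori moment
bound), initial datum `fin`: a weak-* continuous family of measures supported in the
isoperimetric region, with locally uniformly bounded `(v^(-al) + v^be)`-moments,
satisfying the weak identity for all test functions and times. -/
def IsWeakSolution (K : ℝ × ℝ → ℝ × ℝ → ℝ) (r : ℝ × ℝ → ℝ) (c al be : ℝ)
    (fin : Measure (ℝ × ℝ)) (f : ℝ → Measure (ℝ × ℝ)) : Prop :=
  (∀ t, 0 ≤ t → IsIsoMeasure (f t)) ∧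
  (∀ φ, IsC0Quad φ → ContinuousOn (fun t => ∫ η, φ η ∂(f t)) (Ici (0 : ℝ))) ∧
  (∀ T > (0 : ℝ), ∃ C : ℝ≥0∞, C ≠ ⊤ ∧ ∀ t ∈ Icc (0 : ℝ) T,
      (∫⁻ η, ENNReal.ofReal (η.2 ^ (-al) + η.2 ^ be) ∂(f t)) ≤ C) ∧
  (∀ ψ, IsTestFun ψ → ∀ t, 0 ≤ t → WeakIdentity K r c fin f ψ t)

/-- The regularized fusion kernel `r̄_ε(a,v) = r(a,v)/(1 + ε^(2μ+2) a^μ)`. -/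
def rbarFn (r : ℝ × ℝ → ℝ) (mu ε : ℝ) (η : ℝ × ℝ) : ℝ :=
  r η / (1 + ε ^ (2 * mu + 2) * η.1 ^ mu)

end

/-- The size `a + v⁻¹ + v` of a particle. -/
noncomputable def particleSize (η : ℝ × ℝ) : ℝ := η.1 + η.2⁻¹ + η.2

/-- The second moment weight `a² + v⁻² + v²`. -/
noncomputable def momentWeight (η : ℝ × ℝ) : ℝ := η.1 ^ (2 : ℝ) + η.2 ^ (-2 : ℝ) + η.2 ^ (2 : ℝ)

/-- A continuous cutoff equal to `1` on `[n⁻¹, n]` and vanishing outside `[(2n)⁻¹, 2n]`. -/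
noncomputable def cutoff (n x : ℝ) : ℝ := max 0 (min 1 (min (2 * n * x - 1) (2 - x / n)))

/-- The product cutoff in both variables. -/
noncomputable def quadCutoff (n : ℝ) (η : ℝ × ℝ) : ℝ := cutoff n η.1 * cutoff n η.2

lemma one_le_c0 : 1 ≤ c0 := by
  unfold c0
  apply Real.one_le_rpow _ (by norm_num)
  nlinarith [Real.pi_gt_three]

lemma IsoRegion_subset_Quad : IsoRegion ⊆ Quad := by
  rintro ⟨a, v⟩ ⟨hv, ha⟩
  refine ⟨lt_of_lt_of_le ?_ ha, hv⟩
  have := one_le_c0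
  have hv' : 0 < v := hv
  positivity

lemma IsIsoMeasure.ae_mem {m : Measure (ℝ × ℝ)} (hm : IsIsoMeasure m) :
    ∀ᵐ η ∂m, η ∈ IsoRegion := hm

lemma continuous_cutoff (n : ℝ) : Continuous (cutoff n) := by
  unfold cutoff
  fun_prop

lemma cutoff_nonneg (n x : ℝ) : 0 ≤ cutoff n x := le_max_left _ _

lemma cutoff_le_one (n x : ℝ) : cutoff n x ≤ 1 :=
  max_le zero_le_one (min_le_left _ _)

lemma cutoff_eq_one {n x : ℝ} (hn : 0 < n) (h₁ : n⁻¹ ≤ x) (h₂ : x ≤ n) : cutoff n x = 1 := by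
  have h₃ : 1 ≤ n * x := by
    calc 1 = n * n⁻¹ := by field_simp
      _ ≤ n * x := by gcongr
  have h₄ : x / n ≤ 1 := (div_le_one hn).2 h₂
  unfold cutoff
  rw [min_eq_left (le_min (by linarith) (by linarith)), max_eq_right zero_le_one]

lemma mem_Icc_of_cutoff_ne_zero {n x : ℝ} (hn : 0 < n) (h : cutoff n x ≠ 0) :
    x ∈ Icc (2 * n)⁻¹ (2 * n) := by
  have h₀ : 0 < cutoff n x := lt_of_le_of_ne (cutoff_nonneg n x) h.symm
  simp only [cutoff, lt_max_iff, lt_irrefl, lt_min_iff, false_or] at h₀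
  obtain ⟨-, h₁, h₂⟩ := h₀
  constructor
  · rw [inv_le_iff_one_le_mul₀ (by positivity)]
    linarith
  · have : x / n ≤ 2 := by linarith
    rwa [div_le_iff₀ hn] at this

lemma quadCutoff_nonneg (n : ℝ) (η : ℝ × ℝ) : 0 ≤ quadCutoff n η :=
  mul_nonneg (cutoff_nonneg _ _) (cutoff_nonneg _ _)

lemma quadCutoff_le_one (n : ℝ) (η : ℝ × ℝ) : quadCutoff n η ≤ 1 :=
  mul_le_one₀ (cutoff_le_one _ _) (cutoff_nonneg _ _) (cutoff_le_one _ _)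

lemma continuous_quadCutoff (n : ℝ) : Continuous (quadCutoff n) :=
  ((continuous_cutoff n).comp continuous_fst).mul ((continuous_cutoff n).comp continuous_snd)

lemma isCcQuad_mul_quadCutoff {h : ℝ × ℝ → ℝ} (hh : Continuous h) {n : ℝ} (hn : 0 < n) :
    IsCcQuad (fun η => h η * quadCutoff n η) := by
  have hsupp : tsupport (fun η => h η * quadCutoff n η) ⊆
      Icc (2 * n)⁻¹ (2 * n) ×ˢ Icc (2 * n)⁻¹ (2 * n) := by
    refine closure_minimal (fun η hη => ?_) (isClosed_Icc.prod isClosed_Icc)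
    have h₀ : quadCutoff n η ≠ 0 := right_ne_zero_of_mul hη
    exact ⟨mem_Icc_of_cutoff_ne_zero hn (left_ne_zero_of_mul h₀),
      mem_Icc_of_cutoff_ne_zero hn (right_ne_zero_of_mul h₀)⟩
  have hpos : 0 < (2 * n)⁻¹ := by positivity
  refine ⟨hh.mul (continuous_quadCutoff n), ?_, hsupp.trans fun η hη => ?_⟩
  · exact (isCompact_Icc.prod isCompact_Icc).of_isClosed_subset (isClosed_tsupport _) hsupp
  · exact ⟨hpos.trans_le hη.1.1, hpos.trans_le hη.2.1⟩

lemma tendsto_quadCutoff {η : ℝ × ℝ} (hη : η ∈ Quad) :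
    Tendsto (fun N : ℕ => quadCutoff ((N : ℝ) + 1) η) atTop (𝓝 1) := by
  have key : ∀ x : ℝ, 0 < x → ∀ᶠ N : ℕ in atTop, cutoff ((N : ℝ) + 1) x = 1 := by
    intro x hx
    filter_upwards [eventually_ge_atTop ⌈x⌉₊, eventually_ge_atTop ⌈x⁻¹⌉₊] with N h₁ h₂
    have h₁' : x ≤ N := Nat.ceil_le.1 h₁
    have h₂' : x⁻¹ ≤ N := Nat.ceil_le.1 h₂
    refine cutoff_eq_one (by positivity) ?_ (by linarith)
    exact inv_le_of_inv_le₀ hx (by linarith)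
  refine tendsto_const_nhds.congr' ?_
  filter_upwards [key _ hη.1, key _ hη.2] with N h₁ h₂
  simp [quadCutoff, h₁, h₂]

lemma two_le_particleSize {η : ℝ × ℝ} (hη : η ∈ Quad) : 2 ≤ particleSize η := by
  obtain ⟨ha, hv⟩ := hη
  have : 2 ≤ η.2⁻¹ + η.2 := by
    have h : η.2⁻¹ * η.2 = 1 := inv_mul_cancel₀ hv.ne'
    have h' : 0 < η.2⁻¹ := inv_pos.2 hv
    nlinarith [sq_nonneg (η.2⁻¹ - η.2)]
  unfold particleSize
  linarith

lemma sq_particleSize_le {η : ℝ × ℝ} (hη : η ∈ Quad) :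
    particleSize η ^ 2 ≤ 3 * momentWeight η := by
  have h : momentWeight η = η.1 ^ 2 + η.2⁻¹ ^ 2 + η.2 ^ 2 := by
    unfold momentWeight
    rw [Real.rpow_neg hη.2.le, Real.rpow_two, Real.rpow_two, inv_pow]
  rw [h]
  unfold particleSize
  nlinarith [sq_nonneg (η.1 - η.2), sq_nonneg (η.1 - η.2⁻¹), sq_nonneg (η.2 - η.2⁻¹)]

lemma momentWeight_nonneg {η : ℝ × ℝ} (hη : η ∈ Quad) : 0 ≤ momentWeight η := by
  obtain ⟨ha, hv⟩ := hη
  unfold momentWeight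
  positivity

lemma measurable_momentWeight : Measurable momentWeight := by
  unfold momentWeight
  fun_prop

lemma bounds_of_particleSize_le {η : ℝ × ℝ} (hη : η ∈ IsoRegion) {n : ℝ} (hn : 1 ≤ n)
    (h : particleSize η ≤ n / 2) :
    (n⁻¹ ≤ η.1 ∧ η.1 ≤ n / 2) ∧ n⁻¹ ≤ η.2 ∧ η.2 ≤ n / 2 := by
  obtain ⟨ha, hv⟩ := IsoRegion_subset_Quad hη
  have hv' : 0 < η.2⁻¹ := inv_pos.2 hv
  unfold particleSize at h
  have hv₁ : n⁻¹ ≤ η.2 := inv_le_of_inv_le₀ hv (by linarith)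
  have hn' : 0 < n⁻¹ := by positivity
  refine ⟨⟨?_, by linarith⟩, hv₁, by linarith⟩
  have h₁ : n⁻¹ ≤ n⁻¹ ^ ((2 : ℝ) / 3) :=
    Real.self_le_rpow_of_le_one hn'.le (inv_le_one_of_one_le₀ hn) (by norm_num)
  have h₂ : n⁻¹ ^ ((2 : ℝ) / 3) ≤ η.2 ^ ((2 : ℝ) / 3) :=
    Real.rpow_le_rpow hn'.le hv₁ (by norm_num)
  have h₃ : η.2 ^ ((2 : ℝ) / 3) ≤ c0 * η.2 ^ ((2 : ℝ) / 3) :=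
    le_mul_of_one_le_left (by positivity) one_le_c0
  exact (h₁.trans h₂).trans (h₃.trans hη.2)

/-- The truncation of a linear function is additive on pairs of moderate size. -/
lemma truncation_increment_eq_zero (h : ℝ × ℝ →L[ℝ] ℝ) {η η' : ℝ × ℝ} (hη : η ∈ IsoRegion)
    (hη' : η' ∈ IsoRegion) {n : ℝ} (hn : 1 ≤ n) (h₁ : particleSize η ≤ n / 2)
    (h₂ : particleSize η' ≤ n / 2) :
    h (η + η') * quadCutoff n (η + η') - h η * quadCutoff n η - h η' * quadCutoff n η' = 0 := by
  obtain ⟨⟨p₁, p₂⟩, p₃, p₄⟩ := bounds_of_particleSize_le hη hn h₁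
  obtain ⟨⟨q₁, q₂⟩, q₃, q₄⟩ := bounds_of_particleSize_le hη' hn h₂
  have hn₀ : 0 < n := by linarith
  have hn' : 0 < n⁻¹ := by positivity
  have e₁ : quadCutoff n η = 1 := by
    rw [quadCutoff, cutoff_eq_one hn₀ p₁ (by linarith), cutoff_eq_one hn₀ p₃ (by linarith), one_mul]
  have e₂ : quadCutoff n η' = 1 := by
    rw [quadCutoff, cutoff_eq_one hn₀ q₁ (by linarith), cutoff_eq_one hn₀ q₃ (by linarith), one_mul]
  have e₃ : quadCutoff n (η + η') = 1 := by
    rw [quadCutoff, Prod.fst_add, Prod.snd_add, cutoff_eq_one hn₀ (by linarith) (by linarith),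
      cutoff_eq_one hn₀ (by linarith) (by linarith), one_mul]
  rw [e₁, e₂, e₃, map_add]
  ring

lemma abs_truncation_increment_le (h : ℝ × ℝ →L[ℝ] ℝ)
    (hh : ∀ η ∈ Quad, 0 ≤ h η ∧ h η ≤ particleSize η) {η η' : ℝ × ℝ} (hη : η ∈ Quad)
    (hη' : η' ∈ Quad) (n : ℝ) :
    |h (η + η') * quadCutoff n (η + η') - h η * quadCutoff n η - h η' * quadCutoff n η'| ≤
      particleSize η * particleSize η' := by
  obtain ⟨p₁, p₂⟩ := hh η hη
  obtain ⟨q₁, q₂⟩ := hh η' hη'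
  have hg := two_le_particleSize hη
  have hg' := two_le_particleSize hη'
  have hsum : h η + h η' ≤ particleSize η * particleSize η' := by nlinarith
  have key : ∀ ξ, 0 ≤ h ξ → 0 ≤ h ξ * quadCutoff n ξ ∧ h ξ * quadCutoff n ξ ≤ h ξ :=
    fun ξ hξ => ⟨mul_nonneg hξ (quadCutoff_nonneg n ξ),
      mul_le_of_le_one_right hξ (quadCutoff_le_one n ξ)⟩
  have k₁ := key η p₁
  have k₂ := key η' q₁
  have k₃ := key (η + η') (by rw [map_add]; linarith)
  have e : h (η + η') = h η + h η' := map_add h η η'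
  rw [abs_le]
  constructor <;> linarith [k₁.1, k₁.2, k₂.1, k₂.2, k₃.1, k₃.2]

lemma IsCoagKernel.abs_le_rpow_particleSize {K : ℝ × ℝ → ℝ × ℝ → ℝ} {K₀ K₁ al be : ℝ}
    (hK : IsCoagKernel K K₀ K₁ al be) {η η' : ℝ × ℝ} (hη : η ∈ Quad) (hη' : η' ∈ Quad) :
    |K η η'| ≤ 2 * K₀ * (particleSize η ^ be * particleSize η' ^ be) := by
  have hK₁ := hK.K1_pos
  have hK₀ : 0 < K₀ := hK₁.trans_le hK.K1_le_K0
  have hv : ∀ ξ ∈ Quad, 0 ≤ ξ.2 ^ (-al) ∧ ξ.2 ^ (-al) ≤ particleSize ξ ^ be ∧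
      0 ≤ ξ.2 ^ be ∧ ξ.2 ^ be ≤ particleSize ξ ^ be := by
    intro ξ hξ
    have h2 := two_le_particleSize hξ
    obtain ⟨ha, hv⟩ := hξ
    have hv' : 0 < ξ.2⁻¹ := inv_pos.2 hv
    refine ⟨by positivity, ?_, by positivity, ?_⟩
    · rw [Real.rpow_neg hv.le, ← Real.inv_rpow hv.le]
      calc ξ.2⁻¹ ^ al ≤ particleSize ξ ^ al :=
            Real.rpow_le_rpow hv'.le (by unfold particleSize; linarith) hK.al_pos.le
        _ ≤ particleSize ξ ^ be :=
            Real.rpow_le_rpow_of_exponent_le (by linarith) (by linarith [hK.be_sub_al_mem.1])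
    · exact Real.rpow_le_rpow hv.le (by unfold particleSize; linarith) hK.be_mem.1.le
  obtain ⟨p₁, p₂, p₃, p₄⟩ := hv η hη
  obtain ⟨q₁, q₂, q₃, q₄⟩ := hv η' hη'
  have hg : 0 ≤ particleSize η ^ be := p₃.trans p₄
  have hg' : 0 ≤ particleSize η' ^ be := q₃.trans q₄
  have hnn : 0 ≤ K η η' := le_trans (by positivity) (hK.lower η hη η' hη')
  rw [abs_of_nonneg hnn]
  calc K η η' ≤ K₀ * (η.2 ^ (-al) * η'.2 ^ be + η'.2 ^ (-al) * η.2 ^ be) :=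
        hK.upper η hη η' hη'
    _ ≤ K₀ * (particleSize η ^ be * particleSize η' ^ be +
          particleSize η' ^ be * particleSize η ^ be) := by gcongr
    _ = 2 * K₀ * (particleSize η ^ be * particleSize η' ^ be) := by ring

lemma rpow_particleSize_le_of_large {be n x y : ℝ} (hbe : be < 1) (hn : 0 < n)
    (hx : 1 ≤ x) (hy : 1 ≤ y) (h : n / 2 < x) :
    (x ^ be * y ^ be) * (x * y) ≤ (n / 2) ^ (be - 1) * (x ^ 2 * y ^ 2) := by
  have hx₀ : 0 < x := by linarith
  have hy₀ : 0 < y := by linarith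
  have h₁ : x ^ be ≤ (n / 2) ^ (be - 1) * x := by
    calc x ^ be = x ^ (be - 1) * x := by
          rw [← Real.rpow_add_one hx₀.ne', sub_add_cancel]
      _ ≤ (n / 2) ^ (be - 1) * x := by
          gcongr ?_ * _
          exact Real.rpow_le_rpow_of_nonpos (by positivity) h.le (by linarith)
  have h₂ : y ^ be ≤ y := Real.rpow_le_self_of_one_le hy hbe.le
  calc (x ^ be * y ^ be) * (x * y) ≤ (((n / 2) ^ (be - 1) * x) * y) * (x * y) := by gcongr
    _ = (n / 2) ^ (be - 1) * (x ^ 2 * y ^ 2) := by ring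

lemma IsCoagKernel.abs_mul_truncation_increment_le {K : ℝ × ℝ → ℝ × ℝ → ℝ} {K₀ K₁ al be : ℝ}
    (hK : IsCoagKernel K K₀ K₁ al be) (h : ℝ × ℝ →L[ℝ] ℝ)
    (hh : ∀ η ∈ Quad, 0 ≤ h η ∧ h η ≤ particleSize η) {η η' : ℝ × ℝ} (hη : η ∈ IsoRegion)
    (hη' : η' ∈ IsoRegion) {n : ℝ} (hn : 1 ≤ n) :
    |K η η' * (h (η + η') * quadCutoff n (η + η') - h η * quadCutoff n η -
        h η' * quadCutoff n η')| ≤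
      18 * K₀ * (n / 2) ^ (be - 1) * (momentWeight η * momentWeight η') := by
  have hQ := IsoRegion_subset_Quad hη
  have hQ' := IsoRegion_subset_Quad hη'
  have hK₀ : 0 < K₀ := hK.K1_pos.trans_le hK.K1_le_K0
  have hg := two_le_particleSize hQ
  have hg' := two_le_particleSize hQ'
  have hm := momentWeight_nonneg hQ
  have hm' := momentWeight_nonneg hQ'
  by_cases hsmall : particleSize η ≤ n / 2 ∧ particleSize η' ≤ n / 2
  · rw [truncation_increment_eq_zero h hη hη' hn hsmall.1 hsmall.2, mul_zero, abs_zero]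
    positivity
  have hlarge : (particleSize η ^ be * particleSize η' ^ be) *
      (particleSize η * particleSize η') ≤
      (n / 2) ^ (be - 1) * (particleSize η ^ 2 * particleSize η' ^ 2) := by
    rw [not_and_or, not_le, not_le] at hsmall
    rcases hsmall with h₁ | h₁
    · exact rpow_particleSize_le_of_large hK.be_mem.2 (by linarith) (by linarith) (by linarith) h₁
    · have := rpow_particleSize_le_of_large hK.be_mem.2 (n := n) (y := particleSize η)
        (by linarith) (by linarith) (by linarith) h₁
      linarith
  rw [abs_mul]
  calc _ ≤ (2 * K₀ * (particleSize η ^ be * particleSize η' ^ be)) *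
          (particleSize η * particleSize η') :=
        mul_le_mul (hK.abs_le_rpow_particleSize hQ hQ') (abs_truncation_increment_le h hh hQ hQ' n)
          (abs_nonneg _) (by positivity)
    _ = 2 * K₀ * ((particleSize η ^ be * particleSize η' ^ be) *
          (particleSize η * particleSize η')) := by ring
    _ ≤ 2 * K₀ * ((n / 2) ^ (be - 1) * (particleSize η ^ 2 * particleSize η' ^ 2)) := by gcongr
    _ ≤ 2 * K₀ * ((n / 2) ^ (be - 1) * ((3 * momentWeight η) * (3 * momentWeight η'))) := by
        have e := sq_particleSize_le hQ
        have e' := sq_particleSize_le hQ'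
        gcongr
    _ = 18 * K₀ * (n / 2) ^ (be - 1) * (momentWeight η * momentWeight η') := by ring

lemma IsIsoMeasure.integrable_momentWeight {m : Measure (ℝ × ℝ)} (hm : IsIsoMeasure m)
    {C : ℝ≥0∞} (hC : C ≠ ⊤) (h : ∫⁻ η, ENNReal.ofReal (momentWeight η) ∂m ≤ C) :
    Integrable momentWeight m ∧ 0 ≤ ∫ η, momentWeight η ∂m ∧
      ∫ η, momentWeight η ∂m ≤ C.toReal := by
  have hnn : 0 ≤ᵐ[m] momentWeight := by
    filter_upwards [hm.ae_mem] with η hη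
    exact momentWeight_nonneg (IsoRegion_subset_Quad hη)
  refine ⟨⟨measurable_momentWeight.aestronglyMeasurable, ?_⟩, integral_nonneg_of_ae hnn, ?_⟩
  · rw [hasFiniteIntegral_iff_ofReal hnn]
    exact h.trans_lt hC.lt_top
  · rw [integral_eq_lintegral_of_nonneg_ae hnn measurable_momentWeight.aestronglyMeasurable]
    exact ENNReal.toReal_mono hC h

lemma norm_integral_integral_le {m : Measure (ℝ × ℝ)} {F : ℝ × ℝ → ℝ × ℝ → ℝ}
    {w : ℝ × ℝ → ℝ} {S : Set (ℝ × ℝ)} (hS : ∀ᵐ η ∂m, η ∈ S) {D : ℝ} (hw : Integrable w m)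
    (hF : ∀ η ∈ S, ∀ η' ∈ S, |F η η'| ≤ D * (w η * w η')) :
    ‖∫ η, ∫ η', F η η' ∂m ∂m‖ ≤ D * (∫ η, w η ∂m) ^ 2 := by
  have inner : ∀ᵐ η ∂m, ‖∫ η', F η η' ∂m‖ ≤ D * (w η * ∫ η', w η' ∂m) := by
    filter_upwards [hS] with η hη
    calc ‖∫ η', F η η' ∂m‖ ≤ ∫ η', D * (w η * w η') ∂m :=
          norm_integral_le_of_norm_le ((hw.const_mul _).const_mul _)
            (by filter_upwards [hS] with η' hη' using hF η hη η' hη')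
      _ = D * (w η * ∫ η', w η' ∂m) := by rw [integral_const_mul, integral_const_mul]
  calc _ ≤ ∫ η, D * (w η * ∫ η', w η' ∂m) ∂m :=
        norm_integral_le_of_norm_le ((hw.mul_const _).const_mul _) inner
    _ = D * (∫ η, w η ∂m) ^ 2 := by rw [integral_const_mul, integral_mul_const, sq]

/-- If the integrals of dominated truncations of `h ≥ 0` converge, their limit is the integral
of `h`, with the convention that the integral of a nonintegrable function is zero. -/
lemma integral_eq_of_tendsto_integral_truncation {α : Type*} [MeasurableSpace α]
    {m : Measure α} {h : α → ℝ} {φ : ℕ → α → ℝ} (hφm : ∀ n, AEStronglyMeasurable (φ n) m)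
    (hφ : ∀ᵐ x ∂m, ∀ n, 0 ≤ φ n x ∧ φ n x ≤ h x)
    (hlim : ∀ᵐ x ∂m, Tendsto (fun n => φ n x) atTop (𝓝 (h x))) {L : ℝ}
    (hL : Tendsto (fun n => ∫ x, φ n x ∂m) atTop (𝓝 L)) : ∫ x, h x ∂m = L := by
  have hnorm : ∀ n, ∀ᵐ x ∂m, ‖φ n x‖ ≤ h x := fun n => by
    filter_upwards [hφ] with x hx
    rw [Real.norm_of_nonneg (hx n).1]
    exact (hx n).2
  by_cases hint : Integrable h m
  · exact tendsto_nhds_unique (tendsto_integral_of_dominated_convergence h hφm hint hnorm hlim) hL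
  rw [integral_undef hint]
  by_cases hfreq : ∃ᶠ n in atTop, ¬ Integrable (φ n) m
  · by_contra hne
    have hev := hL.eventually_ne (Ne.symm hne)
    obtain ⟨n, hn, hn'⟩ := (hfreq.and_eventually hev).exists
    exact hn' (integral_undef hn)
  · exfalso
    apply hint
    have hev : ∀ᶠ n in atTop, Integrable (φ n) m := by
      simpa only [not_frequently, not_not] using hfreq
    have hmeas : AEStronglyMeasurable h m := aestronglyMeasurable_of_tendsto_ae atTop hφm hlim
    have hnn : 0 ≤ᵐ[m] h := by
      filter_upwards [hφ] with x hx using (hx 0).1.trans (hx 0).2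
    refine ⟨hmeas, ?_⟩
    rw [hasFiniteIntegral_iff_ofReal hnn]
    have hlin : Tendsto (fun n => ∫⁻ x, ENNReal.ofReal (φ n x) ∂m) atTop
        (𝓝 (ENNReal.ofReal L)) := by
      refine (ENNReal.tendsto_ofReal hL).congr' ?_
      filter_upwards [hev] with n hn
      refine ofReal_integral_eq_lintegral_ofReal hn ?_
      filter_upwards [hφ] with x hx using (hx n).1
    calc ∫⁻ x, ENNReal.ofReal (h x) ∂m
        = ∫⁻ x, liminf (fun n => ENNReal.ofReal (φ n x)) atTop ∂m := by
          refine lintegral_congr_ae ?_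
          filter_upwards [hlim] with x hx
          exact (ENNReal.tendsto_ofReal hx).liminf_eq.symm
      _ ≤ liminf (fun n => ∫⁻ x, ENNReal.ofReal (φ n x) ∂m) atTop :=
          lintegral_liminf_le' fun n => (hφm n).aemeasurable.ennreal_ofReal
      _ = ENNReal.ofReal L := hlin.liminf_eq
      _ < ⊤ := ENNReal.ofReal_lt_top

lemma ae_truncation_bounds {m : Measure (ℝ × ℝ)} (hm : IsIsoMeasure m) (h : ℝ × ℝ →L[ℝ] ℝ)
    (hh : ∀ η ∈ Quad, 0 ≤ h η) :
    ∀ᵐ η ∂m, ∀ N : ℕ, 0 ≤ h η * quadCutoff ((N : ℝ) + 1) η ∧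
      h η * quadCutoff ((N : ℝ) + 1) η ≤ h η := by
  filter_upwards [hm.ae_mem] with η hη N
  have h₀ := hh η (IsoRegion_subset_Quad hη)
  exact ⟨mul_nonneg h₀ (quadCutoff_nonneg _ _),
    mul_le_of_le_one_right h₀ (quadCutoff_le_one _ _)⟩

lemma ae_tendsto_truncation {m : Measure (ℝ × ℝ)} (hm : IsIsoMeasure m) (h : ℝ × ℝ →L[ℝ] ℝ) :
    ∀ᵐ η ∂m, Tendsto (fun N : ℕ => h η * quadCutoff ((N : ℝ) + 1) η) atTop (𝓝 (h η)) := by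
  filter_upwards [hm.ae_mem] with η hη
  simpa using (tendsto_quadCutoff (IsoRegion_subset_Quad hη)).const_mul (h η)

/-- Weak solutions with bounded second moments conserve the integral of every linear function
dominated by the particle size. -/
lemma integral_linear_conserved {K : ℝ × ℝ → ℝ × ℝ → ℝ} {K₀ K₁ al be : ℝ}
    (hK : IsCoagKernel K K₀ K₁ al be) {fin : Measure (ℝ × ℝ)} (hfin_iso : IsIsoMeasure fin)
    {fund : ℝ → Measure (ℝ × ℝ)} {t : ℝ} (ht : 0 ≤ t)
    (hiso : ∀ s ∈ Icc (0 : ℝ) t, IsIsoMeasure (fund s))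
    (hsol : ∀ φ : ℝ × ℝ → ℝ, IsCcQuad φ →
      (∫ η, φ η ∂(fund t)) - (∫ η, φ η ∂fin)
        = ∫ s in (0 : ℝ)..t, ∫ η, ∫ η',
            K η η' * (φ (η + η') - φ η - φ η') ∂(fund s) ∂(fund s))
    {C : ℝ≥0∞} (hC : C ≠ ⊤)
    (hmom : ∀ s ∈ Icc (0 : ℝ) t, ∫⁻ η, ENNReal.ofReal (momentWeight η) ∂(fund s) ≤ C)
    (h : ℝ × ℝ →L[ℝ] ℝ) (hh : ∀ η ∈ Quad, 0 ≤ h η ∧ h η ≤ particleSize η) :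
    ∫ η, h η ∂(fund t) = ∫ η, h η ∂fin := by
  have hK₀ : 0 < K₀ := hK.K1_pos.trans_le hK.K1_le_K0
  let φ : ℕ → ℝ × ℝ → ℝ := fun N η => h η * quadCutoff ((N : ℝ) + 1) η
  have hφc : ∀ N, Continuous (φ N) := fun N => h.continuous.mul (continuous_quadCutoff _)
  have htt : t ∈ Icc (0 : ℝ) t := ⟨ht, le_rfl⟩
  have hbound : ∀ N : ℕ, ‖(∫ η, φ N η ∂(fund t)) - ∫ η, φ N η ∂fin‖ ≤
      18 * K₀ * (((N : ℝ) + 1) / 2) ^ (be - 1) * C.toReal ^ 2 * |t - 0| := by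
    intro N
    rw [hsol (φ N) (isCcQuad_mul_quadCutoff h.continuous (by positivity))]
    refine intervalIntegral.norm_integral_le_of_norm_le_const fun s hs => ?_
    rw [uIoc_of_le ht] at hs
    have hs' : s ∈ Icc (0 : ℝ) t := Ioc_subset_Icc_self hs
    obtain ⟨hi, h₀, h₁⟩ := (hiso s hs').integrable_momentWeight hC (hmom s hs')
    calc _ ≤ 18 * K₀ * (((N : ℝ) + 1) / 2) ^ (be - 1) *
          (∫ η, momentWeight η ∂(fund s)) ^ 2 :=
          norm_integral_integral_le (hiso s hs').ae_mem hi fun η hη η' hη' =>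
            hK.abs_mul_truncation_increment_le h hh hη hη' (by simp)
      _ ≤ _ := by gcongr
  have hzero : Tendsto (fun N : ℕ => 18 * K₀ * (((N : ℝ) + 1) / 2) ^ (be - 1) *
      C.toReal ^ 2 * |t - 0|) atTop (𝓝 0) := by
    have h₁ : Tendsto (fun N : ℕ => ((N : ℝ) + 1) / 2) atTop atTop :=
      (tendsto_atTop_add_const_right _ _ tendsto_natCast_atTop_atTop).atTop_div_const two_pos
    have h₂ : Tendsto (fun x : ℝ => x ^ (be - 1)) atTop (𝓝 0) := by
      simpa using tendsto_rpow_neg_atTop (show 0 < 1 - be by linarith [hK.be_mem.2])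
    simpa using (((h₂.comp h₁).const_mul (18 * K₀)).mul_const (C.toReal ^ 2)).mul_const |t - 0|
  have hdiff := squeeze_zero_norm hbound hzero
  have hint : Integrable h (fund t) := by
    refine ((hiso t htt).integrable_momentWeight hC (hmom t htt)).1.const_mul 3 |>.mono'
      h.continuous.aestronglyMeasurable ?_
    filter_upwards [(hiso t htt).ae_mem] with η hη
    have hQ := IsoRegion_subset_Quad hη
    rw [Real.norm_of_nonneg (hh η hQ).1]
    nlinarith [(hh η hQ).2, two_le_particleSize hQ, sq_particleSize_le hQ]
  have hlimt : Tendsto (fun N => ∫ η, φ N η ∂(fund t)) atTop (𝓝 (∫ η, h η ∂(fund t))) := by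
    refine tendsto_integral_of_dominated_convergence h
      (fun N => (hφc N).aestronglyMeasurable) hint (fun N => ?_)
      (ae_tendsto_truncation (hiso t htt) h)
    filter_upwards [ae_truncation_bounds (hiso t htt) h fun η hη => (hh η hη).1] with η hη
    rw [Real.norm_of_nonneg (hη N).1]
    exact (hη N).2
  have hlimin : Tendsto (fun N => ∫ η, φ N η ∂fin) atTop (𝓝 (∫ η, h η ∂(fund t))) := by
    simpa using hlimt.sub hdiff
  exact (integral_eq_of_tendsto_integral_truncation (fun N => (hφc N).aestronglyMeasurable)
    (ae_truncation_bounds hfin_iso h fun η hη => (hh η hη).1)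
    (ae_tendsto_truncation hfin_iso h) hlimin).symm

/-- conservation of total area and total volume for the limit solution of
the two-dimensional pure coagulation equation. -/
theorem pure_coagulation_conservation
    (K : ℝ × ℝ → ℝ × ℝ → ℝ) (K₀ K₁ al be : ℝ) (hK : IsCoagKernel K K₀ K₁ al be)
    (T : ℝ) (hT : 0 < T)
    (fin : Measure (ℝ × ℝ)) (hfin_iso : IsIsoMeasure fin)
    (fund : ℝ → Measure (ℝ × ℝ))
    (hiso : ∀ t ∈ Icc (0 : ℝ) T, IsIsoMeasure (fund t))
    (hcont : ∀ φ, IsC0Quad φ →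
      ContinuousOn (fun t => ∫ η, φ η ∂(fund t)) (Icc (0 : ℝ) T))
    -- f̲ is a weak solution of the two-dimensional pure coagulation equation
    (hsol : ∀ t ∈ Icc (0 : ℝ) T, ∀ φ : ℝ × ℝ → ℝ, IsCcQuad φ →
      (∫ η, φ η ∂(fund t)) - (∫ η, φ η ∂fin)
        = ∫ s in (0 : ℝ)..t, ∫ η, ∫ η',
            K η η' * (φ (η + η') - φ η - φ η') ∂(fund s) ∂(fund s))
    -- moment bound sup_{t∈[0,T]} ∫ (a² + v⁻² + v²) df̲(t) ≤ C(T)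
    (hmom : ∃ C : ℝ≥0∞, C ≠ ⊤ ∧ ∀ t ∈ Icc (0 : ℝ) T,
      (∫⁻ η : ℝ × ℝ, ENNReal.ofReal
        (η.1 ^ (2 : ℝ) + η.2 ^ (-2 : ℝ) + η.2 ^ (2 : ℝ)) ∂(fund t)) ≤ C) :
    ∀ t ∈ Icc (0 : ℝ) T,
      (∫ η : ℝ × ℝ, η.1 ∂(fund t)) = (∫ η : ℝ × ℝ, η.1 ∂fin) ∧
      (∫ η : ℝ × ℝ, η.2 ∂(fund t)) = (∫ η : ℝ × ℝ, η.2 ∂fin) := by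
  obtain ⟨C, hC, hmom⟩ := hmom
  intro t ht
  have hsub : Icc (0 : ℝ) t ⊆ Icc 0 T := Icc_subset_Icc_right ht.2
  have key := integral_linear_conserved hK hfin_iso ht.1 (fun s hs => hiso s (hsub hs))
    (hsol t ht) hC (fun s hs => hmom s (hsub hs))
  refine ⟨key (ContinuousLinearMap.fst ℝ ℝ ℝ) ?_, key (ContinuousLinearMap.snd ℝ ℝ ℝ) ?_⟩
  all_goals
    rintro ⟨a, v⟩ ⟨ha, hv⟩
    simp only at ha hv
    have hv' : 0 < v⁻¹ := inv_pos.2 hv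
    simp only [ContinuousLinearMap.coe_fst', ContinuousLinearMap.coe_snd', particleSize]
    constructor <;> linarith
end

section
/- (Dual transport equation: existence and uniform bounds.) Let μ > 0, ε ∈ (0,1), R > 1, T > 0, and let r be an admissible fusion kernel with exponent μ. Set r̄_ε(a,v) := r(a,v)/(1 + ε^{2μ+2} a^μ) and S := {(a,v) ∈ (0,∞)² : a ≥ c₀ v^{2/3}}. Let χ ∈ C¹_b(S) with χ(a,v) = 0 whenever v ∉ [1/R, R]. Then there exists a solution φ_ε ∈ W_T of the backward transport equation ∂_t φ_ε(t,a,v) + (1/ε) r̄_ε(a,v)(c₀ v^{2/3} − a) ∂_a φ_ε(t,a,v) = 0 on [0,T] × S with terminal condition φ_ε(T, ·) = χ. Moreover, if ‖χ‖_∞ + ‖∂_a χ‖_∞ ≤ 1, there exists a constant C(T), independent of ε and of χ, such that sup_{t∈[0,T]} (‖φ_ε(t)‖_∞ + ‖∂_a φ_ε(t)‖_∞) ≤ C(T). -/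
open MeasureTheory Real Set Filter Topology
open scoped ENNReal

/-- Hadamard's lemma: increments of a `C¹` function are given by a continuous family of
linear forms. -/
lemma exists_continuous_slope {X : Type*} [NormedAddCommGroup X] [NormedSpace ℝ X]
    {F : X → ℝ} (hF : ContDiff ℝ 1 F) :
    ∃ V : X × X → X →L[ℝ] ℝ, Continuous V ∧ ∀ x y, F y - F x = V (x, y) (y - x) := by
  have hc : Continuous (fderiv ℝ F) := hF.continuous_fderiv one_ne_zero
  refine ⟨fun p => ∫ θ in (0 : ℝ)..1, fderiv ℝ F (p.1 + θ • (p.2 - p.1)), ?_, fun x y => ?_⟩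
  · refine intervalIntegral.continuous_parametric_intervalIntegral_of_continuous' ?_ 0 1
    exact hc.comp (by fun_prop)
  · have hcont : Continuous fun θ : ℝ => fderiv ℝ F (x + θ • (y - x)) := hc.comp (by fun_prop)
    rw [ContinuousLinearMap.intervalIntegral_apply (hcont.intervalIntegrable 0 1)]
    have hd : ∀ θ ∈ uIcc (0 : ℝ) 1, HasDerivAt (fun θ : ℝ => F (x + θ • (y - x)))
        (fderiv ℝ F (x + θ • (y - x)) (y - x)) θ := fun θ _ => by
      have h1 : HasDerivAt (fun θ : ℝ => x + θ • (y - x)) (y - x) θ := by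
        simpa using ((hasDerivAt_id θ).smul_const (y - x)).const_add x
      exact ((hF.differentiable one_ne_zero _).hasFDerivAt).comp_hasDerivAt θ h1
    rw [intervalIntegral.integral_eq_sub_of_hasDerivAt hd
      ((hcont.clm_apply continuous_const).intervalIntegrable 0 1)]
    simp

/-- Variation of constants for a scalar linear equation on `[0, 1]`. -/
lemma variation_of_constants {α β D : ℝ → ℝ} (hα : Continuous α) (hβ : Continuous β)
    (hD : ∀ τ ∈ Icc (0 : ℝ) 1, HasDerivAt D (α τ * D τ + β τ) τ) :
    D 1 = exp (∫ τ in (0 : ℝ)..1, α τ) *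
      (D 0 + ∫ τ in (0 : ℝ)..1, exp (-∫ σ in (0 : ℝ)..τ, α σ) * β τ) := by
  have hI : ∀ τ, HasDerivAt (fun τ => ∫ σ in (0 : ℝ)..τ, α σ) (α τ) τ := fun τ =>
    hα.integral_hasStrictDerivAt 0 τ |>.hasDerivAt
  have hIc : Continuous fun τ => ∫ σ in (0 : ℝ)..τ, α σ :=
    continuous_iff_continuousAt.2 fun τ => (hI τ).continuousAt
  have hd : ∀ τ ∈ uIcc (0 : ℝ) 1,
      HasDerivAt (fun τ => exp (-∫ σ in (0 : ℝ)..τ, α σ) * D τ)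
        (exp (-∫ σ in (0 : ℝ)..τ, α σ) * β τ) τ := fun τ hτ => by
    rw [uIcc_of_le zero_le_one] at hτ
    refine ((hI τ).fun_neg.exp.fun_mul (hD τ hτ)).congr_deriv ?_
    ring
  rw [intervalIntegral.integral_eq_sub_of_hasDerivAt hd
    ((hIc.neg.rexp.mul hβ).intervalIntegrable 0 1)]
  simp only [intervalIntegral.integral_same, neg_zero, exp_zero, one_mul, add_sub_cancel]
  rw [← mul_assoc, ← exp_add]
  simp

section ParameterDependence

variable {E : Type*} [NormedAddCommGroup E] [NormedSpace ℝ E] [FiniteDimensional ℝ E]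

/-- Locally bounded solution families of a `C¹` equation depend continuously on initial data and
parameters, uniformly on `[0, 1]`. -/
lemma exists_continuous_trajectory {F : ℝ × E → ℝ} (hF : ContDiff ℝ 1 F) {Ω : Set (ℝ × E)}
    {Z : ℝ → ℝ × E → ℝ} (h0 : ∀ p ∈ Ω, Z 0 p = p.1)
    (hZ : ∀ p ∈ Ω, ∀ τ, HasDerivAt (fun τ => Z τ p) (F (Z τ p, p.2)) τ)
    (hb : ∀ p ∈ Ω, ∃ M, ∀ᶠ q in 𝓝[Ω] p, ∀ τ ∈ Icc (0 : ℝ) 1, |Z τ q| ≤ M) :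
    ∃ Y : Ω → C(Icc (0 : ℝ) 1, ℝ), Continuous Y ∧ ∀ p τ, Y p τ = Z τ p := by
  have hcont : ∀ p : Ω, Continuous fun τ => Z τ p := fun p =>
    continuous_iff_continuousAt.2 fun τ => (hZ p p.2 τ).continuousAt
  refine ⟨fun p => ⟨fun τ => Z τ p, (hcont p).comp continuous_subtype_val⟩, ?_, fun _ _ => rfl⟩
  rw [continuous_iff_continuousAt]
  intro p
  obtain ⟨M, hM⟩ := hb p p.2
  have hpM := hM.self_of_nhdsWithin p.2
  set K : Set (ℝ × E) := Metric.closedBall 0 M ×ˢ Metric.closedBall p.1.2 1 with hK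
  have hKc : IsCompact K := (isCompact_closedBall _ _).prod (isCompact_closedBall _ _)
  have hKconv : Convex ℝ K := (convex_closedBall _ _).prod (convex_closedBall _ _)
  let G : ℝ × E → ℝ × E := fun z => (F z, 0)
  have hG : ContDiff ℝ 1 G := hF.prodMk contDiff_const
  obtain ⟨C, hC⟩ := hKc.exists_bound_of_continuousOn
    (hG.continuous_fderiv one_ne_zero).continuousOn
  have hLip : LipschitzOnWith (C.toNNReal) G K := by
    refine hKconv.lipschitzOnWith_of_nnnorm_fderiv_le (𝕜 := ℝ)
      (fun x _ => hG.differentiable one_ne_zero x) fun x hx => ?_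
    rw [← NNReal.coe_le_coe, coe_nnnorm]
    exact (hC x hx).trans (Real.le_coe_toNNReal C)
  have hder : ∀ q : Ω, ∀ τ, HasDerivAt (fun τ => (Z τ q, q.1.2)) (G (Z τ q, q.1.2)) τ :=
    fun q τ => (hZ q q.2 τ).prodMk (hasDerivAt_const τ q.1.2)
  have hcd : ∀ q : Ω, Continuous fun τ => (Z τ q, q.1.2) := fun q =>
    (hcont q).prodMk continuous_const
  have hM' : ∀ᶠ q : Ω in 𝓝 p, ∀ τ ∈ Icc (0 : ℝ) 1, |Z τ q| ≤ M := by
    rw [nhds_subtype_eq_comap_nhdsWithin]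
    exact hM.comap _
  have hball : ∀ᶠ q : Ω in 𝓝 p, q.1.2 ∈ Metric.closedBall p.1.2 1 :=
    (continuous_snd.comp continuous_subtype_val).continuousAt.eventually
      (Metric.closedBall_mem_nhds _ one_pos)
  rw [ContinuousAt, tendsto_iff_dist_tendsto_zero]
  refine squeeze_zero' (g := fun q : Ω => dist q.1 p.1 * exp (C.toNNReal)) ?_ ?_ ?_
  · exact Eventually.of_forall fun _ => dist_nonneg
  · filter_upwards [hM', hball] with q hq hqb
    rw [ContinuousMap.dist_le (by positivity)]
    intro τ
    have hstart : dist ((Z 0 q, q.1.2) : ℝ × E) (Z 0 p, p.1.2) ≤ dist q.1 p.1 := by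
      rw [h0 q q.2, h0 p p.2]
    have key := dist_le_of_trajectories_ODE_of_mem (v := fun _ => G) (s := fun _ => K)
      (K := C.toNNReal) (a := 0) (b := 1) (fun _ _ => hLip)
      (hcd q).continuousOn (fun t _ => (hder q t).hasDerivWithinAt)
      (fun t ht => ⟨by simpa using hq t (Ico_subset_Icc_self ht), hqb⟩)
      (hcd p).continuousOn (fun t _ => (hder p t).hasDerivWithinAt)
      (fun t ht => ⟨by simpa using hpM t (Ico_subset_Icc_self ht), by simp⟩)
      hstart τ τ.2
    refine (le_max_left _ _).trans (key.trans ?_)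
    gcongr
    nlinarith [τ.2.1, τ.2.2, C.toNNReal.2]
  · have : Tendsto (fun q : Ω => dist q.1 p.1) (𝓝 p) (𝓝 0) :=
      tendsto_iff_dist_tendsto_zero.1 continuous_subtype_val.continuousAt
    simpa using this.mul_const (exp (C.toNNReal))

/-- The time-one map of a locally bounded family of solutions of a scalar `C¹` equation with
parameters is `C¹` on the set of data on which it is defined. -/
theorem contDiffOn_time_one {F : ℝ × E → ℝ} (hF : ContDiff ℝ 1 F) {Ω : Set (ℝ × E)}
    {Z : ℝ → ℝ × E → ℝ} (h0 : ∀ p ∈ Ω, Z 0 p = p.1)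
    (hZ : ∀ p ∈ Ω, ∀ τ, HasDerivAt (fun τ => Z τ p) (F (Z τ p, p.2)) τ)
    (hb : ∀ p ∈ Ω, ∃ M, ∀ᶠ q in 𝓝[Ω] p, ∀ τ ∈ Icc (0 : ℝ) 1, |Z τ q| ≤ M) :
    ContDiffOn ℝ 1 (Z 1) Ω := by
  obtain ⟨Y, hYc, hY⟩ := exists_continuous_trajectory hF h0 hZ hb
  obtain ⟨V, hVc, hV⟩ := exists_continuous_slope hF
  let z : ℝ → Ω → ℝ × E := fun τ p => (Y p (projIcc 0 1 zero_le_one τ), p.1.2)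
  have hz : ∀ τ ∈ Icc (0 : ℝ) 1, ∀ p, z τ p = (Z τ p, p.1.2) := fun τ hτ p => by
    simp only [z, hY, projIcc_of_mem zero_le_one hτ]
  have hzc : Continuous fun x : ℝ × Ω => z x.1 x.2 := by
    have : Continuous fun x : ℝ × Ω => Y x.2 (projIcc 0 1 zero_le_one x.1) :=
      (hYc.comp continuous_snd).eval (continuous_projIcc.comp continuous_fst)
    exact this.prodMk (by fun_prop)
  let W : (Ω × Ω) → ℝ → (ℝ × E →L[ℝ] ℝ) := fun pq τ => V (z τ pq.1, z τ pq.2)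
  have hWc : Continuous (Function.uncurry W) := by
    refine hVc.comp ((hzc.comp (f := fun x : (Ω × Ω) × ℝ => (x.2, x.1.1)) (by fun_prop)).prodMk
      (hzc.comp (f := fun x : (Ω × Ω) × ℝ => (x.2, x.1.2)) (by fun_prop)))
  let α : (Ω × Ω) → ℝ → ℝ := fun pq τ => W pq τ (1, 0)
  have hαc : Continuous (Function.uncurry α) := hWc.clm_apply continuous_const
  let P : (ℝ × E) →L[ℝ] (ℝ × E) :=
    (ContinuousLinearMap.inr ℝ ℝ E).comp (ContinuousLinearMap.snd ℝ ℝ E)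
  let N : (Ω × Ω) → ℝ → (ℝ × E →L[ℝ] ℝ) := fun pq τ =>
    exp (-∫ σ in (0 : ℝ)..τ, α pq σ) • (W pq τ).comp P
  have hNc : Continuous (Function.uncurry N) := by
    have h1 : Continuous fun x : (Ω × Ω) × ℝ => ∫ σ in (0 : ℝ)..x.2, α x.1 σ :=
      intervalIntegral.continuous_parametric_primitive_of_continuous hαc
    exact h1.neg.rexp.smul (hWc.clm_comp continuous_const)
  let L : (Ω × Ω) → (ℝ × E →L[ℝ] ℝ) := fun pq =>
    exp (∫ τ in (0 : ℝ)..1, α pq τ) •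
      (ContinuousLinearMap.fst ℝ ℝ E + ∫ τ in (0 : ℝ)..1, N pq τ)
  have hLc : Continuous L := by
    have h1 := intervalIntegral.continuous_parametric_intervalIntegral_of_continuous'
      (μ := volume) hαc 0 1
    have h2 := intervalIntegral.continuous_parametric_intervalIntegral_of_continuous'
      (μ := volume) hNc 0 1
    exact h1.rexp.smul (continuous_const.add h2)
  have hL : ∀ p q : Ω, Z 1 q - Z 1 p = L (p, q) (q.1 - p.1) := by
    intro p q
    have hW1 : Continuous (W (p, q)) := hWc.comp (by fun_prop : Continuous fun τ => ((p, q), τ))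
    have hα1 : Continuous (α (p, q)) := hW1.clm_apply continuous_const
    have hN1 : Continuous (N (p, q)) := hNc.comp (by fun_prop : Continuous fun τ => ((p, q), τ))
    have hD : ∀ τ ∈ Icc (0 : ℝ) 1, HasDerivAt (fun τ => Z τ q - Z τ p)
        (α (p, q) τ * (Z τ q - Z τ p) + W (p, q) τ (0, q.1.2 - p.1.2)) τ := fun τ hτ => by
      refine ((hZ q q.2 τ).fun_sub (hZ p p.2 τ)).congr_deriv ?_
      rw [hV]
      simp only [α, W, hz τ hτ]
      have : (((Z τ q, q.1.2) - (Z τ p, p.1.2) : ℝ × E)) =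
          (Z τ q - Z τ p) • ((1, 0) : ℝ × E) + (0, q.1.2 - p.1.2) := by ext <;> simp
      rw [this, map_add, map_smul, smul_eq_mul, mul_comm]
    have := variation_of_constants hα1 (hW1.clm_apply continuous_const) hD
    rw [this]
    simp only [L, smul_apply, add_apply,
      ContinuousLinearMap.intervalIntegral_apply (hN1.intervalIntegrable 0 1), h0 _ q.2, h0 _ p.2,
      smul_eq_mul]
    simp [N, P]
  have hderiv : ∀ p (hp : p ∈ Ω), HasFDerivWithinAt (Z 1) (L (⟨p, hp⟩, ⟨p, hp⟩)) Ω p := by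
    intro p hp
    rw [hasFDerivWithinAt_iff_isLittleO, Asymptotics.isLittleO_iff]
    intro c hc
    have hcl : ContinuousAt (fun q : Ω => L (⟨p, hp⟩, q)) ⟨p, hp⟩ := by fun_prop
    have h1 := Metric.continuousAt_iff'.1 hcl c hc
    rw [nhds_subtype_eq_comap_nhdsWithin, eventually_comap] at h1
    filter_upwards [h1, self_mem_nhdsWithin] with q hq hqΩ
    have h2 := hq ⟨q, hqΩ⟩ rfl
    rw [hL ⟨p, hp⟩ ⟨q, hqΩ⟩, ← sub_apply]
    refine (ContinuousLinearMap.le_opNorm _ _).trans ?_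
    gcongr
    rw [← dist_eq_norm]
    exact h2.le
  classical
  rw [show (1 : WithTop ℕ∞) = 0 + 1 from (zero_add 1).symm,
    contDiffOn_succ_iff_hasFDerivWithinAt (by simp)]
  refine fun p hp => ⟨Ω, by rw [insert_eq_of_mem hp]; exact self_mem_nhdsWithin, by simp,
    fun q => if hq : q ∈ Ω then L (⟨q, hq⟩, ⟨q, hq⟩) else 0, fun q hq => ?_, ?_⟩
  · simpa [hq] using hderiv q hq
  · rw [contDiffOn_zero, continuousOn_iff_continuous_domRestrict]
    have : Continuous fun q : Ω => L (q, q) := by fun_prop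
    refine this.congr fun q => ?_
    simp

end ParameterDependence

/-- A `C¹` function on `ℝ` with derivative bounded below by a positive constant has a `C¹`
inverse. -/
lemma exists_inverse_of_le_deriv {H h : ℝ → ℝ} (hH : ∀ y, HasDerivAt H (h y) y) {c : ℝ}
    (hc : 0 < c) (hh : ∀ y, c ≤ h y) :
    ∃ K : ℝ → ℝ, (∀ y, K (H y) = y) ∧ (∀ s, H (K s) = s) ∧ StrictMono K ∧
      ∀ s, HasDerivAt K (h (K s))⁻¹ s := by
  have hHc : Continuous H := continuous_iff_continuousAt.2 fun y => (hH y).continuousAt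
  have hmono : StrictMono H := strictMono_of_hasDerivAt_pos hH fun y => hc.trans_le (hh y)
  have hm : Monotone fun y => H y - c * y := by
    have hd : ∀ y, HasDerivAt (fun y => H y - c * y) (h y - c) y := fun y => by
      simpa using (hH y).fun_sub ((hasDerivAt_id y).const_mul c)
    refine monotone_of_deriv_nonneg (fun y => (hd y).differentiableAt) fun y => ?_
    rw [(hd y).deriv]
    linarith [hh y]
  have hsurj : Function.Surjective H := by
    refine hHc.surjective ?_ ?_
    · refine tendsto_atTop_mono' atTop (f₁ := fun y => H 0 + c * y) ?_ ?_
      · filter_upwards [eventually_ge_atTop 0] with y hy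
        have := hm hy
        simp only at this
        linarith
      · exact tendsto_atTop_add_const_left _ _ (tendsto_id.const_mul_atTop hc)
    · refine tendsto_atBot_mono' atBot (f₁ := fun y => H 0 + c * y) ?_ ?_
      · filter_upwards [eventually_le_atBot 0] with y hy
        have := hm hy
        simp only at this
        linarith
      · exact tendsto_atBot_add_const_left _ _ (tendsto_id.const_mul_atBot hc)
  let e := hmono.orderIsoOfSurjective H hsurj
  have he : ∀ s, H (e.symm s) = s := fun s => e.apply_symm_apply s
  refine ⟨e.symm, fun y => e.symm_apply_apply y, he, e.symm.strictMono, fun s => ?_⟩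
  exact (hH _).of_local_left_inverse e.symm.continuous.continuousAt
    (hc.trans_le (hh _)).ne' (Eventually.of_forall he)

/-- The global flow on `[0, ∞)` of `z' = -f z`, where `f` is positive on `(0, ∞)`, vanishes at `0`
and grows at most linearly. -/
lemma exists_flow_of_le_linear {f : ℝ → ℝ} (hf : ContinuousOn f (Ioi 0)) (hf0 : f 0 = 0)
    (hpos : ∀ z, 0 < z → 0 < f z) {C : ℝ} (hC : ∀ z, 0 < z → f z ≤ C * z) :
    ∃ Y : ℝ → ℝ → ℝ, (∀ z, 0 ≤ z → Y 0 z = z) ∧ (∀ s, Y s 0 = 0) ∧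
      (∀ s z, 0 < z → 0 < Y s z) ∧
      (∀ s z, 0 ≤ z → HasDerivAt (fun s => Y s z) (-f (Y s z)) s) ∧
      (∀ s z, 0 < z → HasDerivAt (Y s) (f (Y s z) / f z) z) ∧
      ∀ s z, 0 ≤ s → 0 ≤ z → Y s z ≤ z := by
  have hCpos : 0 < C := by
    have h1 := hpos 1 one_pos
    have h2 := hC 1 one_pos
    linarith
  let h : ℝ → ℝ := fun y => exp y / f (exp y)
  have hfe : ∀ y, 0 < f (exp y) := fun y => hpos _ (exp_pos y)
  have hhc : Continuous h := by
    have h1 : Continuous fun y => f (exp y) :=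
      hf.comp_continuous continuous_exp fun y => exp_pos y
    exact continuous_exp.div h1 fun y => (hfe y).ne'
  have hH : ∀ y, HasDerivAt (fun y => ∫ x in (0 : ℝ)..y, h x) (h y) y := fun y =>
    (hhc.integral_hasStrictDerivAt 0 y).hasDerivAt
  have hhl : ∀ y, C⁻¹ ≤ h y := fun y => by
    rw [inv_eq_one_div, div_le_div_iff₀ hCpos (hfe y)]
    linarith [hC _ (exp_pos y)]
  obtain ⟨K, hKH, hHK, hKm, hK⟩ := exists_inverse_of_le_deriv hH (inv_pos.2 hCpos) hhl
  set H : ℝ → ℝ := fun y => ∫ x in (0 : ℝ)..y, h x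
  let Y : ℝ → ℝ → ℝ := fun s z => if 0 < z then exp (K (H (log z) - s)) else 0
  have hY : ∀ s z, 0 < z → Y s z = exp (K (H (log z) - s)) := fun s z hz => if_pos hz
  have hY0 : ∀ s, Y s 0 = 0 := fun s => if_neg (lt_irrefl 0)
  refine ⟨Y, fun z hz => ?_, hY0, fun s z hz => ?_, fun s z hz => ?_, fun s z hz => ?_,
    fun s z hs hz => ?_⟩
  · rcases hz.eq_or_lt with rfl | hz
    · exact hY0 0
    · rw [hY 0 z hz, sub_zero, hKH, exp_log hz]
  · rw [hY s z hz]
    exact exp_pos _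
  · rcases hz.eq_or_lt with rfl | hz
    · simp only [hY0, hf0, neg_zero]
      exact hasDerivAt_const _ _
    · simp only [hY _ z hz]
      have h1 := ((hK (H (log z) - s)).comp s ((hasDerivAt_id s).const_sub (H (log z)))).exp
      refine h1.congr_deriv ?_
      simp only [h, Function.comp, inv_div]
      field_simp
  · have h1 := ((hK (H (log z) - s)).comp z
      (((hH (log z)).comp z (hasDerivAt_log hz.ne')).sub_const s)).exp
    have h2 : Y s =ᶠ[𝓝 z] fun z => exp (K (H (log z) - s)) := by
      filter_upwards [lt_mem_nhds hz] with w hw using hY s w hw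
    refine (h1.congr_of_eventuallyEq h2).congr_deriv ?_
    have h3 := hpos z hz
    simp only [h, Function.comp, inv_div, exp_log hz, hY s z hz]
    field_simp
  · rcases hz.eq_or_lt with rfl | hz
    · exact (hY0 s).le
    · rw [hY s z hz, ← le_log_iff_exp_le hz]
      conv_rhs => rw [← hKH (log z)]
      exact hKm.monotone (by linarith)

/-- A bound for the derivative on an open half-line extends to the (two-sided) derivative at the
end point. -/
lemma abs_deriv_le_of_Ioi {g : ℝ → ℝ} {a K : ℝ} (hK : 0 ≤ K) (hg : ContinuousOn g (Ici a))
    (hd : ∀ x, a < x → DifferentiableAt ℝ g x ∧ |deriv g x| ≤ K) : |deriv g a| ≤ K := by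
  by_cases hga : DifferentiableAt ℝ g a
  swap
  · simpa [deriv_zero_of_not_differentiableAt hga] using hK
  have h1 := hga.hasDerivAt.hasDerivWithinAt (s := Ioi a)
  rw [hasDerivWithinAt_iff_tendsto_slope' (by simp)] at h1
  refine le_of_tendsto h1.abs ?_
  filter_upwards [self_mem_nhdsWithin] with x hx
  obtain ⟨y, hy, hyx⟩ := exists_deriv_eq_slope g hx (hg.mono Icc_subset_Ici_self)
    fun y hy => (hd y hy.1).1.differentiableWithinAt
  rw [slope_def_field, ← hyx]
  exact (hd y hy.1).2

lemma c0_pos : 0 < c0 := by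
  unfold c0
  positivity

lemma c0_mul_rpow_pos {v : ℝ} (hv : 0 < v) : 0 < c0 * v ^ ((2 : ℝ) / 3) :=
  mul_pos c0_pos (rpow_pos_of_pos hv _)

lemma mem_Quad_of_le {a v : ℝ} (hv : 0 < v) (ha : c0 * v ^ ((2 : ℝ) / 3) ≤ a) : (a, v) ∈ Quad :=
  ⟨(c0_mul_rpow_pos hv).trans_le ha, hv⟩

lemma isOpen_Quad : IsOpen Quad :=
  (isOpen_lt continuous_const continuous_fst).inter (isOpen_lt continuous_const continuous_snd)

/-- The forward flow of `a' = b(a,v) (c₀ v^(2/3) - a)` on the isoperimetric region, for a positive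
rate `b` which is bounded and nondecreasing in `a`. -/
lemma exists_relaxation_flow {b : ℝ × ℝ → ℝ} (hb : ContDiffOn ℝ 1 b Quad)
    (hpos : ∀ η ∈ Quad, 0 < b η)
    (hbd : ∀ v, 0 < v → ∃ C, ∀ a, 0 < a → b (a, v) ≤ C)
    (hmono : ∀ v, 0 < v → MonotoneOn (fun a => b (a, v)) (Ici (c0 * v ^ ((2 : ℝ) / 3)))) :
    ∃ A : ℝ → ℝ × ℝ → ℝ,
      (∀ η ∈ IsoRegion, A 0 η = η.1) ∧
      (∀ s, ∀ η ∈ IsoRegion, (A s η, η.2) ∈ IsoRegion) ∧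
      (∀ s v, A s (c0 * v ^ ((2 : ℝ) / 3), v) = c0 * v ^ ((2 : ℝ) / 3)) ∧
      (∀ s a v, 0 < v → c0 * v ^ ((2 : ℝ) / 3) < a → c0 * v ^ ((2 : ℝ) / 3) < A s (a, v)) ∧
      (∀ s, ∀ η ∈ IsoRegion, HasDerivAt (fun s => A s η)
        (b (A s η, η.2) * (c0 * η.2 ^ ((2 : ℝ) / 3) - A s η)) s) ∧
      (∀ s a v, 0 < v → c0 * v ^ ((2 : ℝ) / 3) < a → ∃ D, HasDerivAt (fun a => A s (a, v)) D a ∧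
        b (a, v) * (c0 * v ^ ((2 : ℝ) / 3) - a) * D =
          b (A s (a, v), v) * (c0 * v ^ ((2 : ℝ) / 3) - A s (a, v)) ∧
        (0 ≤ s → |D| ≤ 1)) ∧
      (∀ s, 0 ≤ s → ∀ η ∈ IsoRegion, A s η ≤ η.1) := by
  choose! C hC using hbd
  have hx : ∀ v, 0 < v → ∀ x, 0 < x → (c0 * v ^ ((2 : ℝ) / 3) + x, v) ∈ Quad := fun v hv x hx =>
    mem_Quad_of_le hv (by linarith)
  have hflow := fun v (hv : 0 < v) =>
    exists_flow_of_le_linear (f := fun x => b (c0 * v ^ ((2 : ℝ) / 3) + x, v) * x) (C := C v)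
      ((hb.continuousOn.comp (by fun_prop) (hx v hv)).mul continuousOn_id) (by simp)
      (fun x h => mul_pos (hpos _ (hx v hv x h)) h)
      (fun x h => mul_le_mul_of_nonneg_right (hC v hv _ (hx v hv x h).1) h.le)
  choose! Y hY0 hYz hYpos hYs hYa hYle using hflow
  have hYnn : ∀ v, 0 < v → ∀ s x, 0 ≤ x → 0 ≤ Y v s x := fun v hv s x hx => by
    rcases hx.eq_or_lt with rfl | hx
    · exact (hYz v hv s).ge
    · exact (hYpos v hv s x hx).le
  let A : ℝ → ℝ × ℝ → ℝ := fun s η => if 0 < η.2 then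
    c0 * η.2 ^ ((2 : ℝ) / 3) + Y η.2 s (η.1 - c0 * η.2 ^ ((2 : ℝ) / 3))
    else c0 * η.2 ^ ((2 : ℝ) / 3)
  have hA : ∀ s a v, 0 < v → A s (a, v) =
      c0 * v ^ ((2 : ℝ) / 3) + Y v s (a - c0 * v ^ ((2 : ℝ) / 3)) := fun s a v hv => if_pos hv
  refine ⟨A, ?_, ?_, ?_, ?_, ?_, ?_, ?_⟩
  · rintro ⟨a, v⟩ ⟨hv, ha⟩
    rw [hA _ _ _ hv, hY0 v hv _ (sub_nonneg.2 ha)]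
    ring
  · rintro s ⟨a, v⟩ ⟨hv, ha⟩
    refine ⟨hv, ?_⟩
    rw [hA _ _ _ hv]
    exact le_add_of_nonneg_right (hYnn v hv s _ (sub_nonneg.2 ha))
  · intro s v
    by_cases hv : 0 < v
    · rw [hA _ _ _ hv, sub_self, hYz v hv, add_zero]
    · exact if_neg hv
  · intro s a v hv ha
    rw [hA _ _ _ hv]
    exact lt_add_of_pos_right _ (hYpos v hv s _ (sub_pos.2 ha))
  · rintro s ⟨a, v⟩ ⟨hv, ha⟩
    simp only [hA _ _ _ hv]
    refine ((hYs v hv s _ (sub_nonneg.2 ha)).const_add _).congr_deriv ?_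
    ring
  · intro s a v hv ha
    have hx := sub_pos.2 ha
    have h1 := ((hYa v hv s _ hx).comp a ((hasDerivAt_id a).sub_const _)).const_add
      (c0 * v ^ ((2 : ℝ) / 3))
    have hba := hpos _ (mem_Quad_of_le hv ha.le)
    have hyp := hYpos v hv s _ hx
    refine ⟨_, h1.congr_of_eventuallyEq (Eventually.of_forall fun a => hA s a v hv), ?_, ?_⟩
    · simp only [add_sub_cancel, hA _ _ _ hv]
      have : a - c0 * v ^ ((2 : ℝ) / 3) ≠ 0 := hx.ne'
      field_simp
      ring
    · intro hs
      have hle := hYle v hv s _ hs hx.le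
      have hby := hpos _ (mem_Quad_of_le (a := c0 * v ^ ((2 : ℝ) / 3) +
        Y v s (a - c0 * v ^ ((2 : ℝ) / 3))) hv (by linarith))
      simp only [add_sub_cancel, mul_one]
      rw [abs_of_nonneg (by positivity), div_le_one (by positivity)]
      refine mul_le_mul ?_ hle hyp.le hba.le
      exact hmono v hv (by simpa using hyp.le) ha.le (by linarith)
  · rintro s hs ⟨a, v⟩ ⟨hv, ha⟩
    rw [hA _ _ _ hv]
    linarith [hYle v hv s _ hs (sub_nonneg.2 ha)]

/-- A forward flow of `a' = b(a,v) (c₀ v^(2/3) - a)` with `C¹` rate `b` is jointly `C¹` up to the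
boundary of the isoperimetric region. -/
lemma contDiffOn_relaxation_flow {b : ℝ × ℝ → ℝ} (hb : ContDiffOn ℝ 1 b Quad)
    {A : ℝ → ℝ × ℝ → ℝ} (h0 : ∀ η ∈ IsoRegion, A 0 η = η.1)
    (hmem : ∀ s, ∀ η ∈ IsoRegion, (A s η, η.2) ∈ IsoRegion)
    (hA : ∀ s, ∀ η ∈ IsoRegion, HasDerivAt (fun s => A s η)
        (b (A s η, η.2) * (c0 * η.2 ^ ((2 : ℝ) / 3) - A s η)) s)
    (hle : ∀ s, 0 ≤ s → ∀ η ∈ IsoRegion, A s η ≤ η.1) :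
    ContDiffOn ℝ 1 (fun q : ℝ × (ℝ × ℝ) => A q.1 q.2) (Ici 0 ×ˢ IsoRegion) := by
  let m : ℝ → ℝ := fun u => c0 * exp u ^ ((2 : ℝ) / 3)
  have hm : ContDiff ℝ 1 m :=
    contDiff_const.mul (contDiff_exp.rpow_const_of_ne fun u => (exp_pos u).ne')
  have hmpos : ∀ u, 0 < m u := fun u => c0_mul_rpow_pos (exp_pos u)
  let ι : ℝ → ℝ → ℝ × ℝ := fun z u => (m u * exp z, exp u)
  have hι : ∀ z u, 0 ≤ z → ι z u ∈ IsoRegion := fun z u hz =>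
    ⟨exp_pos u, le_mul_of_one_le_right (hmpos u).le (one_le_exp hz)⟩
  let F : ℝ × (ℝ × ℝ) → ℝ := fun p => p.2.1 * (b (ι p.1 p.2.2) * (exp (-p.1) - 1))
  have hF : ContDiff ℝ 1 F := by
    have hι' : ContDiff ℝ 1 fun p : ℝ × (ℝ × ℝ) => ι p.1 p.2.2 :=
      ((hm.comp (by fun_prop : ContDiff ℝ 1 fun p : ℝ × (ℝ × ℝ) => p.2.2)).mul
        (by fun_prop)).prodMk (by fun_prop)
    have hbι : ContDiff ℝ 1 fun p : ℝ × (ℝ × ℝ) => b (ι p.1 p.2.2) :=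
      contDiffOn_univ.1 (hb.comp hι'.contDiffOn fun p _ =>
        ⟨mul_pos (hmpos _) (exp_pos _), exp_pos _⟩)
    exact (by fun_prop : ContDiff ℝ 1 fun p : ℝ × (ℝ × ℝ) => p.2.1).mul
      (hbι.mul (by fun_prop))
  let Ω : Set (ℝ × (ℝ × ℝ)) := {p | 0 ≤ p.1 ∧ 0 ≤ p.2.1}
  let Z : ℝ → ℝ × (ℝ × ℝ) → ℝ := fun τ p => log (A (p.2.1 * τ) (ι p.1 p.2.2) / m p.2.2)
  have hge : ∀ p ∈ Ω, ∀ s, m p.2.2 ≤ A s (ι p.1 p.2.2) := fun p hp s =>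
    (hmem s _ (hι _ _ hp.1)).2
  have hZ0 : ∀ p ∈ Ω, Z 0 p = p.1 := fun p hp => by
    have := (hmpos p.2.2).ne'
    simp only [Z, mul_zero, h0 _ (hι _ p.2.2 hp.1), ι]
    rw [mul_div_cancel_left₀ _ this, log_exp]
  have hexp : ∀ p ∈ Ω, ∀ τ, m p.2.2 * exp (Z τ p) = A (p.2.1 * τ) (ι p.1 p.2.2) :=
    fun p hp τ => by
      have h1 := hmpos p.2.2
      simp only [Z]
      rw [exp_log (div_pos (h1.trans_le (hge p hp _)) h1), mul_div_cancel₀ _ h1.ne']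
  have hZ : ∀ p ∈ Ω, ∀ τ, HasDerivAt (fun τ => Z τ p) (F (Z τ p, p.2)) τ := fun p hp τ => by
    have h1 := hmpos p.2.2
    have h2 := h1.trans_le (hge p hp (p.2.1 * τ))
    have h3 := (((hA (p.2.1 * τ) _ (hι _ p.2.2 hp.1)).comp τ
      ((hasDerivAt_id τ).const_mul p.2.1)).div_const (m p.2.2)).log (div_pos h2 h1).ne'
    refine h3.congr_deriv ?_
    have h4 : exp (-Z τ p) = m p.2.2 / A (p.2.1 * τ) (ι p.1 p.2.2) := by
      rw [exp_neg, ← hexp p hp, div_mul_eq_div_div, div_self h1.ne', one_div]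
    simp only [F, h4]
    simp only [ι, hexp p hp, Function.comp] at h2 ⊢
    have h5 : c0 * exp p.2.2 ^ ((2 : ℝ) / 3) = m p.2.2 := rfl
    rw [h5]
    field_simp
  have hbdd : ∀ p ∈ Ω, ∃ M, ∀ᶠ q in 𝓝[Ω] p, ∀ τ ∈ Icc (0 : ℝ) 1, |Z τ q| ≤ M := by
    refine fun p _ => ⟨p.1 + 1, ?_⟩
    have h1 : ∀ᶠ q : ℝ × (ℝ × ℝ) in 𝓝[Ω] p, q.1 < p.1 + 1 :=
      (continuous_fst.continuousAt.eventually_lt continuousAt_const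
        (lt_add_one p.1)).filter_mono nhdsWithin_le_nhds
    filter_upwards [h1, self_mem_nhdsWithin] with q hq hqΩ τ hτ
    have h2 := hmpos q.2.2
    have h3 : 1 ≤ A (q.2.1 * τ) (ι q.1 q.2.2) / m q.2.2 := (one_le_div h2).2 (hge q hqΩ _)
    rw [abs_of_nonneg (log_nonneg h3), log_le_iff_le_exp (by linarith), div_le_iff₀ h2,
      mul_comm (exp _)]
    refine (hle _ (mul_nonneg hqΩ.2 hτ.1) _ (hι _ _ hqΩ.1)).trans ?_
    exact mul_le_mul_of_nonneg_left (exp_le_exp.2 hq.le) h2.le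
  have hmain := contDiffOn_time_one hF hZ0 hZ hbdd
  let κ : ℝ × (ℝ × ℝ) → ℝ × (ℝ × ℝ) := fun q =>
    (log q.2.1 - log (m (log q.2.2)), (q.1, log q.2.2))
  have hlog : ContDiffOn ℝ 1 (fun q : ℝ × (ℝ × ℝ) => log q.2.2) (Ici 0 ×ˢ IsoRegion) :=
    (by fun_prop : ContDiff ℝ 1 fun q : ℝ × (ℝ × ℝ) => q.2.2).contDiffOn.log
      fun q hq => hq.2.1.ne'
  have hmlog : ContDiffOn ℝ 1 (fun q : ℝ × (ℝ × ℝ) => m (log q.2.2)) (Ici 0 ×ˢ IsoRegion) :=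
    hm.comp_contDiffOn hlog
  have hκ : ContDiffOn ℝ 1 κ (Ici 0 ×ˢ IsoRegion) := by
    refine ContDiffOn.prodMk (ContDiffOn.sub ?_ (hmlog.log fun q _ => (hmpos _).ne'))
      (ContDiffOn.prodMk (by fun_prop) hlog)
    exact (by fun_prop : ContDiff ℝ 1 fun q : ℝ × (ℝ × ℝ) => q.2.1).contDiffOn.log
      fun q hq => (mem_Quad_of_le hq.2.1 hq.2.2).1.ne'
  have hpt : ∀ q ∈ Ici (0 : ℝ) ×ˢ IsoRegion, κ q ∈ Ω ∧ ι (κ q).1 (κ q).2.2 = q.2 := by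
    rintro ⟨s, a, v⟩ ⟨hs, hv, ha⟩
    have h1 : m (log v) = c0 * v ^ ((2 : ℝ) / 3) := by simp only [m, exp_log hv]
    have h2 := c0_mul_rpow_pos hv
    refine ⟨⟨sub_nonneg.2 (log_le_log (hmpos _) (h1.trans_le ha)), hs⟩, ?_⟩
    simp only [κ, ι, exp_sub, exp_log hv, exp_log (h2.trans_le ha), exp_log (hmpos _)]
    rw [mul_div_cancel₀ _ (hmpos _).ne']
  refine ((hmlog.mul (hmain.comp hκ fun q hq => (hpt q hq).1).exp)).congr fun q hq => ?_
  have h1 := hexp _ (hpt q hq).1 1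
  rw [(hpt q hq).2, mul_one] at h1
  exact h1.symm

section RegularizedKernel

variable {r : ℝ × ℝ → ℝ} {R₀ R₁ mu sg B ε : ℝ}

lemma one_add_mul_rpow_pos (hε : 0 < ε) {a : ℝ} (ha : 0 < a) :
    0 < 1 + ε ^ (2 * mu + 2) * a ^ mu := by positivity

lemma contDiffOn_rbarFn (hr : IsFusionKernel r R₀ R₁ mu sg B) (hε : 0 < ε) :
    ContDiffOn ℝ 1 (rbarFn r mu ε) Quad := by
  refine hr.smooth.div (contDiffOn_const.add (contDiffOn_const.mul ?_))
    fun η hη => (one_add_mul_rpow_pos hε hη.1).ne'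
  exact contDiff_fst.contDiffOn.rpow_const_of_ne fun η hη => hη.1.ne'

lemma rbarFn_pos (hr : IsFusionKernel r R₀ R₁ mu sg B) (hε : 0 < ε) {η : ℝ × ℝ} (hη : η ∈ Quad) :
    0 < rbarFn r mu ε η :=
  div_pos (hr.pos η hη) (one_add_mul_rpow_pos hε hη.1)

lemma rbarFn_le (hr : IsFusionKernel r R₀ R₁ mu sg B) (hε : 0 < ε) {η : ℝ × ℝ} (hη : η ∈ Quad) :
    rbarFn r mu ε η ≤ R₁ * η.2 ^ sg / ε ^ (2 * mu + 2) := by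
  have h1 : 0 < ε ^ (2 * mu + 2) := rpow_pos_of_pos hε _
  have h2 := rpow_pos_of_pos hη.2 sg
  have h3 := hr.R1_pos
  rw [rbarFn, div_le_div_iff₀ (one_add_mul_rpow_pos hε hη.1) h1]
  nlinarith [mul_le_mul_of_nonneg_right (hr.upper η hη) h1.le, mul_pos h3 h2]

lemma monotoneOn_rbarFn (hr : IsFusionKernel r R₀ R₁ mu sg B) (hmu : 0 < mu) (hε : 0 < ε) {v : ℝ}
    (hv : 0 < v) :
    MonotoneOn (fun a => rbarFn r mu ε (a, v)) (Ici (c0 * v ^ ((2 : ℝ) / 3))) := by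
  have hd : ∀ a, c0 * v ^ ((2 : ℝ) / 3) ≤ a → HasDerivAt (fun a => rbarFn r mu ε (a, v))
      ((da r (a, v) * (1 + ε ^ (2 * mu + 2) * a ^ mu) -
        r (a, v) * (ε ^ (2 * mu + 2) * (mu * a ^ (mu - 1)))) /
        (1 + ε ^ (2 * mu + 2) * a ^ mu) ^ 2) a := fun a ha => by
    have hq := mem_Quad_of_le hv ha
    have h1 : DifferentiableAt ℝ r (a, v) :=
      (hr.smooth.contDiffAt (isOpen_Quad.mem_nhds hq)).differentiableAt one_ne_zero
    have h2 : DifferentiableAt ℝ (fun a => r (a, v)) a :=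
      h1.comp a (by fun_prop : DifferentiableAt ℝ (fun a : ℝ => (a, v)) a)
    have h3 : HasDerivAt (fun a => 1 + ε ^ (2 * mu + 2) * a ^ mu)
        (ε ^ (2 * mu + 2) * (mu * a ^ (mu - 1))) a :=
      ((hasDerivAt_rpow_const (Or.inl hq.1.ne')).const_mul _).const_add _
    exact h2.hasDerivAt.fun_div h3 (one_add_mul_rpow_pos hε hq.1).ne'
  refine monotoneOn_of_deriv_nonneg (convex_Ici _)
    (fun a ha => (hd a ha).continuousAt.continuousWithinAt)
    (fun a ha => (hd a (interior_subset ha)).differentiableAt.differentiableWithinAt)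
    fun a ha => ?_
  have ha' := interior_subset ha
  have hq := mem_Quad_of_le hv ha'
  have ha0 : 0 < a := hq.1
  rw [(hd a ha').deriv]
  refine div_nonneg ?_ (sq_nonneg _)
  have h1 := hr.cond_pos hmu (a, v) ⟨hv, ha'⟩
  have h2 := mul_nonneg h1 (one_add_mul_rpow_pos (mu := mu) hε ha0).le
  have h3 : 0 < mu * a⁻¹ * r (a, v) := mul_pos (by positivity) (hr.pos _ hq)
  rw [rpow_sub_one ha0.ne', div_eq_mul_inv]
  simp only at h2
  linarith

end RegularizedKernel

lemma hasDerivAt_slice_of_contDiffOn {χ : ℝ × ℝ → ℝ} (hχ : ContDiffOn ℝ 1 χ IsoRegion) {a v : ℝ}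
    (hv : 0 < v) (ha : c0 * v ^ ((2 : ℝ) / 3) < a) :
    HasDerivAt (fun a => χ (a, v)) (da χ (a, v)) a := by
  have h1 : DifferentiableOn ℝ (fun a => χ (a, v)) (Ici (c0 * v ^ ((2 : ℝ) / 3))) :=
    (hχ.differentiableOn one_ne_zero).comp
      (by fun_prop : Differentiable ℝ fun a : ℝ => (a, v)).differentiableOn fun a ha => ⟨hv, ha⟩
  exact (h1.differentiableAt (Ici_mem_nhds ha)).hasDerivAt

/-- existence of solutions of the backward dual transport equation with
regularized fusion kernel, and uniform (in ε and in the terminal datum χ) bounds on the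
solution and its a-derivative. -/
theorem dual_transport_existence_and_bounds
    (mu sg R₀ R₁ B : ℝ) (hmu : 0 < mu)
    (R T : ℝ) (hR : 1 < R) (hT : 0 < T)
    (r : ℝ × ℝ → ℝ) (hr : IsFusionKernel r R₀ R₁ mu sg B) :
    ∃ C > (0 : ℝ), ∀ ε ∈ Ioo (0 : ℝ) 1, ∀ χ : ℝ × ℝ → ℝ,
      -- χ ∈ C¹_b(S)
      ContDiffOn ℝ 1 χ IsoRegion →
      (∃ M : ℝ, ∀ η ∈ IsoRegion, |χ η| + |da χ η| ≤ M) →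
      -- χ vanishes for v ∉ [1/R, R]
      (∀ η : ℝ × ℝ, η.2 ∉ Icc (1 / R) R → χ η = 0) →
      ∃ φ : ℝ → ℝ × ℝ → ℝ,
        -- φ ∈ W_T : C¹ in (t,a,v), bounded together with its a-derivative,
        -- vanishing for v ∉ [1/R, R]
        ContDiffOn ℝ 1 (fun q : ℝ × (ℝ × ℝ) => φ q.1 q.2)
          (Icc (0 : ℝ) T ×ˢ IsoRegion) ∧
        (∃ M : ℝ, ∀ t ∈ Icc (0 : ℝ) T, ∀ η ∈ IsoRegion, |φ t η| + |da (φ t) η| ≤ M) ∧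
        (∀ t ∈ Icc (0 : ℝ) T, ∀ η : ℝ × ℝ, η.2 ∉ Icc (1 / R) R → φ t η = 0) ∧
        -- terminal condition φ(T,·) = χ
        (∀ η ∈ IsoRegion, φ T η = χ η) ∧
        -- the backward transport equation with kernel r̄_ε
        (∀ t ∈ Icc (0 : ℝ) T, ∀ η ∈ IsoRegion,
          deriv (fun u => φ u η) t
            + ε⁻¹ * rbarFn r mu ε η * (c0 * η.2 ^ ((2 : ℝ) / 3) - η.1)
              * da (φ t) η = 0) ∧
        -- the uniform bound when ‖χ‖_∞ + ‖∂_a χ‖_∞ ≤ 1, with C independent of ε and χ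
        ((∃ M₁ M₂ : ℝ, M₁ + M₂ ≤ 1 ∧ (∀ η ∈ IsoRegion, |χ η| ≤ M₁) ∧
            (∀ η ∈ IsoRegion, |da χ η| ≤ M₂)) →
          ∀ t ∈ Icc (0 : ℝ) T, ∀ η ∈ IsoRegion, |φ t η| + |da (φ t) η| ≤ C) := by
  refine ⟨1, one_pos, fun ε hε χ hχ hχb hχ0 => ?_⟩
  have hε0 : 0 < ε := hε.1
  have hεi : 0 < ε⁻¹ := inv_pos.2 hε0
  have hb := (contDiffOn_const (c := ε⁻¹)).mul (contDiffOn_rbarFn hr hε0)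
  obtain ⟨A, hA0, hAmem, hAbd, hAgt, hAs, hAa, hAle⟩ :=
    exists_relaxation_flow (b := fun η => ε⁻¹ * rbarFn r mu ε η) hb
      (fun η hη => mul_pos hεi (rbarFn_pos hr hε0 hη))
      (fun v hv => ⟨ε⁻¹ * (R₁ * v ^ sg / ε ^ (2 * mu + 2)), fun a ha => mul_le_mul_of_nonneg_left
        (rbarFn_le hr hε0 (η := (a, v)) ⟨ha, hv⟩) hεi.le⟩)
      (fun v hv a ha a' ha' h => mul_le_mul_of_nonneg_left
        (monotoneOn_rbarFn hr hmu hε0 hv ha ha' h) hεi.le)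
  have hAc := contDiffOn_relaxation_flow hb hA0 hAmem hAs hAle
  let φ : ℝ → ℝ × ℝ → ℝ := fun t η => χ (A (T - t) η, η.2)
  have hφ : ContDiffOn ℝ 1 (fun q : ℝ × (ℝ × ℝ) => φ q.1 q.2) (Icc (0 : ℝ) T ×ˢ IsoRegion) := by
    refine hχ.comp (ContDiffOn.prodMk ?_ (by fun_prop)) fun q hq => hAmem _ _ hq.2
    exact hAc.comp (g := fun q : ℝ × (ℝ × ℝ) => A q.1 q.2)
      (f := fun q : ℝ × (ℝ × ℝ) => (T - q.1, q.2)) (by fun_prop)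
      fun q hq => ⟨sub_nonneg.2 hq.1.2, hq.2⟩
  have hda : ∀ t a v, 0 < v → c0 * v ^ ((2 : ℝ) / 3) < a → ∃ D,
      HasDerivAt (fun a => φ t (a, v)) (da χ (A (T - t) (a, v), v) * D) a ∧
      ε⁻¹ * rbarFn r mu ε (a, v) * (c0 * v ^ ((2 : ℝ) / 3) - a) * D =
        ε⁻¹ * rbarFn r mu ε (A (T - t) (a, v), v) *
          (c0 * v ^ ((2 : ℝ) / 3) - A (T - t) (a, v)) ∧
      (t ≤ T → |D| ≤ 1) := fun t a v hv ha => by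
    obtain ⟨D, hD, hDb, hD1⟩ := hAa (T - t) a v hv ha
    exact ⟨D, HasDerivAt.comp (h₂ := fun x => χ (x, v)) a
      (hasDerivAt_slice_of_contDiffOn hχ hv (hAgt (T - t) a v hv ha)) hD, hDb,
      fun ht => hD1 (sub_nonneg.2 ht)⟩
  have hbound : ∀ M, (∀ η ∈ IsoRegion, |da χ η| ≤ M) →
      ∀ t ∈ Icc (0 : ℝ) T, ∀ η ∈ IsoRegion, |da (φ t) η| ≤ M := by
    rintro M hM t ht ⟨a, v⟩ ⟨hv, ha⟩
    simp only at hv ha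
    have hM0 : 0 ≤ M := (abs_nonneg _).trans (hM (a, v) ⟨hv, ha⟩)
    have hint : ∀ x, c0 * v ^ ((2 : ℝ) / 3) < x → DifferentiableAt ℝ (fun a => φ t (a, v)) x ∧
        |deriv (fun a => φ t (a, v)) x| ≤ M := fun x hx => by
      obtain ⟨D, hD, -, hD1⟩ := hda t x v hv hx
      refine ⟨hD.differentiableAt, ?_⟩
      rw [hD.deriv, abs_mul]
      exact (mul_le_mul (hM _ (hAmem _ (x, v) ⟨hv, hx.le⟩)) (hD1 ht.2) (abs_nonneg _) hM0).trans_eq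
        (mul_one M)
    rcases ha.eq_or_lt with rfl | ha
    · refine abs_deriv_le_of_Ioi hM0 ?_ hint
      exact hφ.continuousOn.comp (g := fun q : ℝ × (ℝ × ℝ) => φ q.1 q.2)
        (f := fun a => (t, (a, v))) (by fun_prop) fun x hx => ⟨ht, hv, hx⟩
    · exact (hint a ha).2
  refine ⟨φ, hφ, ?_, fun t _ η hη => hχ0 _ hη, fun η hη => ?_, ?_, ?_⟩
  · obtain ⟨M, hM⟩ := hχb
    refine ⟨M + M, fun t ht η hη => add_le_add ?_ ?_⟩
    · exact (le_add_of_nonneg_right (abs_nonneg _)).trans (hM _ (hAmem (T - t) η hη))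
    · exact hbound M (fun η hη => (le_add_of_nonneg_left (abs_nonneg _)).trans (hM η hη)) t ht η hη
  · simp only [φ, sub_self, hA0 η hη]
  · rintro t ht ⟨a, v⟩ ⟨hv, ha⟩
    simp only at hv ha
    rcases ha.eq_or_lt with rfl | ha
    · simp [φ, hAbd]
    · obtain ⟨D, hD, hDb, -⟩ := hda t a v hv ha
      have h1 : HasDerivAt (fun u => φ u (a, v)) _ t :=
        HasDerivAt.comp (h₂ := fun x => χ (x, v)) t
          (hasDerivAt_slice_of_contDiffOn hχ hv (hAgt (T - t) a v hv ha))
          ((hAs (T - t) (a, v) ⟨hv, ha.le⟩).comp t ((hasDerivAt_id t).const_sub T))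
      have h2 : da (φ t) (a, v) = _ := hD.deriv
      rw [h1.deriv, h2]
      linear_combination da χ (A (T - t) (a, v), v) * hDb
  · rintro ⟨M₁, M₂, hM, hM₁, hM₂⟩ t ht η hη
    exact (add_le_add (hM₁ _ (hAmem (T - t) η hη)) (hbound M₂ hM₂ t ht η hη)).trans hM
end
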